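/- arXiv:1212.1170 — 2 statements merged into one kernel-verified Lean document; each statement's English description precedes it below -/
import Mathlib

section
/- Let k be a field, let X and Y be schemes of finite type over k, and let g : X → Y be a morphism over k. Let X₁ ⊆ X and Y₁ ⊆ Y be constructible subsets of the underlying topological spaces, with Y₁ nonempty, such that g maps X₁ into Y₁. Let d ≥ 0 be an integer and suppose that for every point y ∈ Y₁, the fiber X₁ ∩ g^{-1}(y), with its subspace topology, has topological Krull dimension equal to d. Then the topological Krull dimension of X₁ equals the topological Krull dimension of Y₁ plus d. -/
open AlgebraicGeometry CategoryTheory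

/-- A constructible subset of a topological space: a finite union of locally closed sets. -/
def IsConstructibleSet {α : Type*} [TopologicalSpace α] (s : Set α) : Prop :=
  ∃ F : Finset (Set α), (∀ t ∈ F, IsLocallyClosed t) ∧ s = ⋃ t ∈ F, t

universe u v

/-- Dimension of a finite type domain is the transcendence degree. -/
theorem exists_dim_eq_trdeg (K A : Type u) [Field K] [CommRing A] [IsDomain A] [Algebra K A]
    [Algebra.FiniteType K A] :
    ∃ n : ℕ, ringKrullDim A = n ∧ Algebra.trdeg K A = n := by
  obtain ⟨s, g, hinj, hint⟩ := exists_integral_inj_algHom_of_fg K A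
  refine ⟨s, ?_, ?_⟩
  · let := g.toRingHom.toAlgebra
    have : Algebra.IsIntegral (MvPolynomial (Fin s) K) A := ⟨hint⟩
    have : FaithfulSMul (MvPolynomial (Fin s) K) A :=
      (faithfulSMul_iff_algebraMap_injective _ _).2 hinj
    have h0 : ringKrullDim (MvPolynomial (Fin s) K) = s := by
      simp
    rw [← h0]
    apply le_antisymm
    · refine Order.krullDim_le_of_strictMono
        (PrimeSpectrum.comap (algebraMap (MvPolynomial (Fin s) K) A)) ?_
      intro p q hpq
      exact Ideal.IsIntegral.comap_lt_comap (R := MvPolynomial (Fin s) K) (I := p.asIdeal)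
        (J := q.asIdeal) hpq
    · refine iSup_le fun l => ?_
      obtain ⟨P, hP, hP'⟩ := Ideal.exists_ideal_over_prime_of_isIntegral (S := A) l.head.asIdeal ⊥
        (by
          intro x hx
          have : x = 0 := (injective_iff_map_eq_zero g).1 hinj x hx
          simp [this])
      have := hP'.1
      have : P.LiesOver l.head.asIdeal := ⟨hP'.2.symm⟩
      obtain ⟨L, hL, -⟩ := Ideal.exists_ltSeries_of_hasGoingUp (S := A) l P
      rw [← hL]
      exact le_iSup (fun l : LTSeries (PrimeSpectrum A) => (l.length : WithBot ℕ∞)) L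
  · let := g.toRingHom.toAlgebra
    have : IsScalarTower K (MvPolynomial (Fin s) K) A := IsScalarTower.of_algHom g
    have : Algebra.IsIntegral (MvPolynomial (Fin s) K) A := ⟨hint⟩
    have : FaithfulSMul (MvPolynomial (Fin s) K) A :=
      (faithfulSMul_iff_algebraMap_injective _ _).2 hinj
    rw [← trdeg_add_eq K (MvPolynomial (Fin s) K) (A := A), trdeg_eq_zero (R := MvPolynomial (Fin s) K)]
    simp [MvPolynomial.trdeg_of_isDomain]

/-- transcendence degree of a ring hom, valued in `ℕ∞`. -/
noncomputable def td {R S : Type u} [CommRing R] [CommRing S] (f : R →+* S) : ℕ∞ :=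
  Cardinal.toENat (@Algebra.trdeg R S _ _ f.toAlgebra)

theorem td_algebraMap (R S : Type u) [CommRing R] [CommRing S] [h : Algebra R S] :
    td (algebraMap R S) = Cardinal.toENat (Algebra.trdeg R S) := by
  unfold td
  have : (algebraMap R S).toAlgebra = h := Algebra.algebra_ext _ _ fun r => rfl
  rw [this]

theorem td_comp {R S T : Type u} [CommRing R] [CommRing S] [CommRing T] [Nontrivial R]
    [IsDomain T] (f : R →+* S) (g : S →+* T) (hf : Function.Injective f)
    (hg : Function.Injective g) : td (g.comp f) = td f + td g := by
  let := f.toAlgebra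
  let := g.toAlgebra
  let := (g.comp f).toAlgebra
  have : IsScalarTower R S T := IsScalarTower.of_algebraMap_eq' rfl
  have : FaithfulSMul R S := (faithfulSMul_iff_algebraMap_injective _ _).2 hf
  have : FaithfulSMul S T := (faithfulSMul_iff_algebraMap_injective _ _).2 hg
  have := trdeg_add_eq R S (A := T)
  unfold td
  rw [← map_add]
  exact congrArg _ this.symm

theorem td_eq_zero {R S : Type u} [CommRing R] [CommRing S] [Nontrivial R] (f : R →+* S)
    (hf : Function.Surjective f) : td f = 0 := by
  let := f.toAlgebra
  have : Algebra.IsAlgebraic R S := by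
    constructor
    intro x
    obtain ⟨r, rfl⟩ := hf x
    exact isAlgebraic_algebraMap r
  have := trdeg_eq_zero (R := R) (A := S)
  unfold td
  exact (congrArg _ this).trans (map_zero _)

theorem td_eq_dim {K A : Type u} [Field K] [CommRing A] [IsDomain A] (f : K →+* A)
    (hf : f.FiniteType) : ∃ n : ℕ, ringKrullDim A = n ∧ td f = n := by
  let := f.toAlgebra
  have : Algebra.FiniteType K A := hf
  obtain ⟨n, h1, h2⟩ := exists_dim_eq_trdeg K A
  refine ⟨n, h1, ?_⟩
  unfold td
  exact (congrArg _ h2).trans (by simp)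

theorem td_residueField {A : Type u} [CommRing A] (p : Ideal A) [p.IsPrime] :
    td (algebraMap (A ⧸ p) p.ResidueField) = 0 := by
  have : Algebra.IsAlgebraic (A ⧸ p) p.ResidueField :=
    IsFractionRing.isAlgebraic_iff' (A ⧸ p) (A ⧸ p) p.ResidueField |>.1 inferInstance
  have := trdeg_eq_zero (R := A ⧸ p) (A := p.ResidueField)
  exact (td_algebraMap _ _).trans ((congrArg _ this).trans (map_zero _))

/-- transcendence degree of the residue field extension at `x`. -/
noncomputable def dl {X Y : Scheme.{u}} (f : X ⟶ Y) (x : X) : ℕ∞ :=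
  td (f.residueFieldMap x).hom

theorem dl_comp {X Y Z : Scheme.{u}} (f : X ⟶ Y) (g : Y ⟶ Z) (x : X) :
    dl (f ≫ g) x = dl g (f x) + dl f x := by
  unfold dl
  rw [Scheme.residueFieldMap_comp]
  exact td_comp _ _ (RingHom.injective _) (RingHom.injective _)

theorem dl_eq_zero {X Y : Scheme.{u}} (f : X ⟶ Y) [IsPreimmersion f] (x : X) : dl f x = 0 := by
  refine td_eq_zero _ ?_
  intro z
  obtain ⟨w, rfl⟩ := X.residue_surjective x z
  obtain ⟨v, rfl⟩ := f.stalkMap_surjective x w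
  refine ⟨Y.residue _ v, ?_⟩
  exact congr($(Scheme.residue_residueFieldMap f x) v)

theorem algebraMap_residueField_surj {K : Type u} [Field K] (q : Ideal K) [q.IsPrime] :
    Function.Surjective (algebraMap K q.ResidueField) := by
  have : q.IsMaximal := by
    obtain rfl | rfl := Ideal.eq_bot_or_top q
    · exact Ideal.bot_isMaximal
    · exact absurd rfl (Ideal.IsPrime.ne_top ‹_›)
  exact Ideal.algebraMap_residueField_surjective q

theorem dl_Spec {K : Type u} [Field K] {A : CommRingCat.{u}} (φ : CommRingCat.of K ⟶ A)
    (p : Spec A) :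
    dl (Spec.map φ) p = td ((Ideal.Quotient.mk p.asIdeal).comp φ.hom) := by
  have h := Scheme.Hom.SpecMap_residueFieldMap_fromSpecResidueField (Spec.map φ) p
  rw [← Scheme.Spec.map_residueFieldIso_inv_eq_fromSpecResidueField,
    ← Scheme.Spec.map_residueFieldIso_inv_eq_fromSpecResidueField] at h
  rw [← Spec.map_comp, ← Spec.map_comp, ← Spec.map_comp, ← Spec.map_comp] at h
  have h2 := Spec.map_injective h
  have hA : td (CommRingCat.Hom.hom (Scheme.Spec.residueFieldIso A p).inv) = 0 :=
    td_eq_zero _ ((ConcreteCategory.bijective_of_isIso _).2)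
  have hpr : (Spec.map φ p).asIdeal.IsPrime := PrimeSpectrum.isPrime _
  have hpr' : p.asIdeal.IsPrime := PrimeSpectrum.isPrime _
  have hK : td ((Scheme.Spec.residueFieldIso (.of K) (Spec.map φ p)).inv.hom.comp
      (algebraMap K (Spec.map φ p).asIdeal.ResidueField)) = 0 := by
    refine td_eq_zero _ ?_
    rw [RingHom.coe_comp]
    exact ((ConcreteCategory.bijective_of_isIso
      (Scheme.Spec.residueFieldIso (.of K) (Spec.map φ p)).inv).2).comp
      (algebraMap_residueField_surj (Spec.map φ p).asIdeal)
  have h3 : ((Spec.map φ).residueFieldMap p).hom.comp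
      ((Scheme.Spec.residueFieldIso (.of K) (Spec.map φ p)).inv.hom.comp
      (algebraMap K (Spec.map φ p).asIdeal.ResidueField)) =
      (Scheme.Spec.residueFieldIso A p).inv.hom.comp
        ((algebraMap (A ⧸ p.asIdeal) p.asIdeal.ResidueField).comp
          ((Ideal.Quotient.mk p.asIdeal).comp φ.hom)) :=
    congrArg CommRingCat.Hom.hom h2
  have h4 := congrArg (fun f => td f) h3
  dsimp only at h4
  have i1 : Function.Injective ((Ideal.Quotient.mk p.asIdeal).comp φ.hom) :=
    RingHom.injective (R := K) _
  have i2 : Function.Injective (algebraMap (A ⧸ p.asIdeal) p.asIdeal.ResidueField) :=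
    Ideal.injective_algebraMap_quotient_residueField _
  have e1 := td_comp _ (algebraMap (A ⧸ p.asIdeal) p.asIdeal.ResidueField) i1 i2
  rw [td_comp (T := (Spec A).residueField p) _ _ (RingHom.injective (R := K) _)
    (RingHom.injective _), hK,
    td_comp (T := (Spec A).residueField p) _ _ (RingHom.injective (R := K) _)
    (RingHom.injective (R := p.asIdeal.ResidueField) _),
    hA, e1, td_residueField, zero_add, add_zero, add_zero] at h4
  exact h4

/-- closure of a point in an affine scheme of finite type over a field -/
theorem dl_Spec_dim {K : Type u} [Field K] {A : CommRingCat.{u}} (φ : CommRingCat.of K ⟶ A)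
    (hφ : φ.hom.FiniteType) (p : Spec A) :
    ∃ n : ℕ, ringKrullDim (A ⧸ p.asIdeal) = n ∧ dl (Spec.map φ) p = n := by
  rw [dl_Spec]
  have hpr : p.asIdeal.IsPrime := PrimeSpectrum.isPrime _
  exact td_eq_dim _ (RingHom.FiniteType.comp_surjective hφ Ideal.Quotient.mk_surjective)

theorem dl_Spec_lt {K : Type u} [Field K] {A : CommRingCat.{u}} (φ : CommRingCat.of K ⟶ A)
    (hφ : φ.hom.FiniteType) (p q : Spec A) (h : p.asIdeal < q.asIdeal) :
    dl (Spec.map φ) q < dl (Spec.map φ) p := by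
  obtain ⟨n, h1, h2⟩ := dl_Spec_dim φ hφ p
  obtain ⟨m, h3, h4⟩ := dl_Spec_dim φ hφ q
  have hpr : p.asIdeal.IsPrime := PrimeSpectrum.isPrime _
  obtain ⟨x, hx, hx'⟩ := SetLike.exists_of_lt h
  have := ringKrullDim_succ_le_of_surjective (Ideal.Quotient.factor h.le)
    (Ideal.Quotient.factor_surjective h.le) (r := Ideal.Quotient.mk _ x)
    (mem_nonZeroDivisors_of_ne_zero (by rwa [Ne, Ideal.Quotient.eq_zero_iff_mem]))
    (by simpa [Ideal.Quotient.eq_zero_iff_mem] using hx)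
  rw [h2, h4]
  rw [h1, h3] at this
  norm_cast at this ⊢

/-- local affine data for a scheme of finite type over a field -/
theorem exists_chart {K : Type u} [Field K] {X : Scheme.{u}} (f : X ⟶ Spec (.of K))
    [LocallyOfFiniteType f] (x : X) (V : Set X) (hV : IsOpen V) (hx : x ∈ V) :
    ∃ (A : CommRingCat.{u}) (φ : CommRingCat.of K ⟶ A) (j : Spec A ⟶ X),
      IsOpenImmersion j ∧ φ.hom.FiniteType ∧ j ≫ f = Spec.map φ ∧ x ∈ Set.range j ∧
      Set.range j ⊆ V ∧ ∀ p, dl f (j p) = dl (Spec.map φ) p := by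
  obtain ⟨A, j, hj, hxj, hjV⟩ :=
    Scheme.exists_affine_mem_range_and_range_subset (X := X) (x := x) (U := ⟨V, hV⟩) hx
  obtain ⟨φ, hφ⟩ := Spec.map_surjective (j ≫ f)
  refine ⟨A, φ, j, hj, ?_, hφ.symm, hxj, hjV, ?_⟩
  · have : LocallyOfFiniteType (Spec.map φ) := hφ ▸ inferInstance
    exact HasRingHomProperty.Spec_iff.mp this
  · intro p
    rw [hφ, dl_comp, dl_eq_zero j, add_zero]

theorem dl_ne_top {K : Type u} [Field K] {X : Scheme.{u}} (f : X ⟶ Spec (.of K))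
    [LocallyOfFiniteType f] (x : X) : dl f x ≠ ⊤ := by
  obtain ⟨A, φ, j, hj, hφ, hjf, ⟨p, rfl⟩, -, hd⟩ := exists_chart f x Set.univ isOpen_univ trivial
  obtain ⟨n, -, h⟩ := dl_Spec_dim φ hφ p
  rw [hd, h]
  exact ENat.natCast_ne_top n

theorem dl_lt {K : Type u} [Field K] {X : Scheme.{u}} (f : X ⟶ Spec (.of K))
    [LocallyOfFiniteType f] (x y : X) (h : x ⤳ y) (hne : x ≠ y) : dl f y < dl f x := by
  obtain ⟨A, φ, j, hj, hφ, hjf, ⟨q, rfl⟩, -, hd⟩ := exists_chart f y Set.univ isOpen_univ trivial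
  obtain ⟨p, rfl⟩ := h.mem_open j.isOpenEmbedding.isOpen_range ⟨q, rfl⟩
  rw [hd, hd]
  have hpq : p ⤳ q := j.isOpenEmbedding.toIsInducing.specializes_iff.1 h
  apply dl_Spec_lt φ hφ
  have hle : p.asIdeal ≤ q.asIdeal := (PrimeSpectrum.le_iff_specializes p q).2 hpq
  refine lt_of_le_of_ne hle fun he => hne ?_
  rw [PrimeSpectrum.ext he]

theorem le_dim_of_mem {K : Type u} [Field K] {X : Scheme.{u}} (f : X ⟶ Spec (.of K))
    [LocallyOfFiniteType f] (Z : Set X) (hZ : IsConstructibleSet Z) (x : X) (hx : x ∈ Z)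
    (n : ℕ) (hn : n ≤ dl f x) : (n : WithBot ℕ∞) ≤ topologicalKrullDim Z := by
  obtain ⟨F, hF, rfl⟩ := hZ
  obtain ⟨t, ht, hxt⟩ := Set.mem_iUnion₂.1 hx
  obtain ⟨V, C, hV, hC, rfl⟩ := hF t ht
  obtain ⟨A, φ, j, hj, hφ, hjf, ⟨p, rfl⟩, hjV, hd⟩ := exists_chart f x V hV hxt.1
  obtain ⟨m, h1, h2⟩ := dl_Spec_dim φ hφ p
  rw [hd, h2] at hn
  have hnm : n ≤ m := by exact_mod_cast hn
  refine le_trans (Nat.cast_le.2 hnm) ?_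
  rw [← h1, ← PrimeSpectrum.topologicalKrullDim_eq_ringKrullDim]
  let c : PrimeSpectrum (A ⧸ p.asIdeal) → Spec A := PrimeSpectrum.comap (Ideal.Quotient.mk p.asIdeal)
  have hc : Topology.IsInducing c :=
    (PrimeSpectrum.isClosedEmbedding_comap_of_surjective _ _
      Ideal.Quotient.mk_surjective).toIsInducing
  have hjc : Topology.IsInducing (j ∘ c) := j.isOpenEmbedding.toIsInducing.comp hc
  have hmem : ∀ w, (j ∘ c) w ∈ ⋃ t ∈ F, t := by
    intro w
    refine Set.mem_iUnion₂.2 ⟨_, ht, hjV ⟨_, rfl⟩, ?_⟩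
    have hs : p ⤳ c w := by
      refine (PrimeSpectrum.le_iff_specializes p (c w)).1 ?_
      intro a ha
      change Ideal.Quotient.mk p.asIdeal a ∈ w.asIdeal
      rw [Ideal.Quotient.eq_zero_iff_mem.2 ha]
      exact zero_mem _
    exact (hs.map j.continuous).mem_closed hC hxt.2
  exact (hjc.codRestrict hmem).topologicalKrullDim_le

theorem quasiSober_of_constructible {α : Type*} [TopologicalSpace α] [QuasiSober α] (Z : Set α)
    (hZ : IsConstructibleSet Z) : QuasiSober Z := by
  obtain ⟨F, hF, rfl⟩ := hZ
  constructor
  intro S hS hS'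
  obtain ⟨D, hD, rfl⟩ := isClosed_induced_iff.1 hS'
  set Z : Set α := ⋃ t ∈ F, t with hZdef
  have hirr : IsIrreducible (((↑) : Z → α) '' (((↑) : Z → α) ⁻¹' D)) :=
    hS.image _ continuous_subtype_val.continuousOn
  obtain ⟨η, hη⟩ := QuasiSober.sober hirr.closure isClosed_closure
  rw [Subtype.image_preimage_coe] at hη hirr
  have hmem : η ∈ closure (Z ∩ D) := hη.mem
  have hU : Z ∩ D = ⋃ t ∈ F, (t ∩ D) := by
    rw [hZdef, Set.iUnion₂_inter]
  rw [hU, Finset.closure_biUnion] at hmem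
  obtain ⟨t, ht, hηt⟩ := Set.mem_iUnion₂.1 hmem
  have hlc : IsLocallyClosed (t ∩ D) := (hF t ht).inter hD.isLocallyClosed
  obtain ⟨V, C, hV, hC, htD⟩ := hlc
  have hηC : η ∈ C := by
    refine closure_minimal ?_ hC hηt
    rw [htD]; exact Set.inter_subset_right
  obtain ⟨z, hz⟩ : (t ∩ D).Nonempty := closure_nonempty_iff.1 ⟨η, hηt⟩
  have hηV : η ∈ V := by
    have hsp : η ⤳ z := by
      refine hη.specializes ?_
      exact subset_closure (by rw [hU]; exact Set.mem_iUnion₂.2 ⟨t, ht, hz⟩)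
    have hzV : z ∈ V := by rw [htD] at hz; exact hz.1
    exact hsp.mem_open hV hzV
  have hηtD : η ∈ t ∩ D := by rw [htD]; exact ⟨hηV, hηC⟩
  have hηZ : η ∈ Z := Set.mem_iUnion₂.2 ⟨t, ht, hηtD.1⟩
  refine ⟨⟨η, hηZ⟩, ?_⟩
  refine Set.Subset.antisymm (closure_minimal (by simpa using hηtD.2) hS') ?_
  intro w hw
  have : η ⤳ (w : α) := hη.specializes (subset_closure ⟨w.2, hw⟩)
  exact ((subtype_specializes_iff _ _).2 this).mem_closure

theorem exists_of_le_dim {K : Type u} [Field K] {X : Scheme.{u}} (f : X ⟶ Spec (.of K))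
    [LocallyOfFiniteType f] (Z : Set X) (hZ : IsConstructibleSet Z)
    (n : ℕ) (hn : (n : WithBot ℕ∞) ≤ topologicalKrullDim Z) : ∃ x ∈ Z, n ≤ dl f x := by
  have := quasiSober_of_constructible Z hZ
  obtain ⟨l, hl⟩ := Order.le_krullDim_iff.1 hn
  have hg : ∀ C : TopologicalSpace.IrreducibleCloseds Z, ∃ z : Z, IsGenericPoint z (C : Set Z) :=
    fun C => QuasiSober.sober C.isIrreducible C.isClosed
  choose γ hγ using hg
  let d : TopologicalSpace.IrreducibleCloseds Z → ℕ := fun C => (dl f (γ C)).toNat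
  have hd : ∀ C, ((d C : ℕ) : ℕ∞) = dl f (γ C) := fun C => ENat.natCast_toNat (dl_ne_top f _)
  have hmono : StrictMono d := by
    intro C C' h
    have hs : γ C' ⤳ γ C := (hγ C').specializes (h.le (hγ C).mem)
    have hne : (γ C' : X) ≠ γ C := by
      intro he
      have he' : γ C' = γ C := Subtype.ext he
      have : (C : Set Z) = C' := by rw [← (hγ C).def, ← (hγ C').def, he']
      exact h.ne (SetLike.coe_injective this)
    have := dl_lt f _ _ ((subtype_specializes_iff _ _).1 hs) hne
    rw [← hd, ← hd] at this
    exact_mod_cast this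
  have hlen := (l.map d hmono).head_add_length_le_nat
  refine ⟨γ l.last, (γ l.last).2, ?_⟩
  rw [← hd]
  have : n ≤ d l.last := by
    have h1 : (l.map d hmono).length = n := hl
    have h2 : (l.map d hmono).last = d l.last := rfl
    omega
  exact_mod_cast this

theorem le_dim_iff {K : Type u} [Field K] {X : Scheme.{u}} (f : X ⟶ Spec (.of K))
    [LocallyOfFiniteType f] (Z : Set X) (hZ : IsConstructibleSet Z)
    (n : ℕ) : (n : WithBot ℕ∞) ≤ topologicalKrullDim Z ↔ ∃ x ∈ Z, n ≤ dl f x :=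
  ⟨exists_of_le_dim f Z hZ n, fun ⟨x, hx, hn⟩ => le_dim_of_mem f Z hZ x hx n hn⟩

theorem IsConstructibleSet.preimage' {α β : Type*} [TopologicalSpace α] [TopologicalSpace β]
    {s : Set β} (hs : IsConstructibleSet s) {f : α → β} (hf : Continuous f) :
    IsConstructibleSet (f ⁻¹' s) := by
  classical
  obtain ⟨F, hF, rfl⟩ := hs
  refine ⟨F.image (fun t => f ⁻¹' t), ?_, ?_⟩
  · intro t ht
    obtain ⟨t', ht', rfl⟩ := Finset.mem_image.1 ht
    exact (hF t' ht').preimage hf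
  · ext x; simp

theorem le_dim_fiber_iff {X Y : Scheme.{u}} (g : X ⟶ Y) [LocallyOfFiniteType g] (Z : Set X)
    (hZ : IsConstructibleSet Z) (y : Y) (n : ℕ) :
    (n : WithBot ℕ∞) ≤ topologicalKrullDim ↥(Z ∩ g.base ⁻¹' {y}) ↔
      ∃ x ∈ Z, g x = y ∧ n ≤ dl g x := by
  have hlft : LocallyOfFiniteType (g.fiberToSpecResidueField y) := by
    have hst : MorphismProperty.IsStableUnderBaseChange @LocallyOfFiniteType :=
      locallyOfFiniteType_isStableUnderBaseChange
    exact hst.of_isPullback (IsPullback.of_hasPullback g (Y.fromSpecResidueField y)) ‹_›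
  have hdl : ∀ z, dl (g.fiberToSpecResidueField y) z = dl g (g.fiberι y z) := by
    intro z
    have h := congrArg (fun h => dl h z) (g.fiber_fac y)
    rw [dl_comp, dl_comp, dl_eq_zero (g.fiberι y), dl_eq_zero (Y.fromSpecResidueField y),
      add_zero, zero_add] at h
    exact h.symm
  have hr := g.range_fiberι y
  have hdim : topologicalKrullDim ↥(g.fiberι y ⁻¹' Z) =
      topologicalKrullDim ↥(Z ∩ g.base ⁻¹' {y}) := by
    have hmaps : ∀ z : ↥(g.fiberι y ⁻¹' Z), g.fiberι y z ∈ Z ∩ g.base ⁻¹' {y} :=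
      fun z => ⟨z.2, hr.le ⟨_, rfl⟩⟩
    let h : ↥(g.fiberι y ⁻¹' Z) → ↥(Z ∩ g.base ⁻¹' {y}) := fun z => ⟨_, hmaps z⟩
    have hi : Topology.IsInducing h :=
      (((g.fiberι y).isEmbedding.toIsInducing).comp .subtypeVal).codRestrict hmaps
    have hinj : Function.Injective h := fun a b hab =>
      Subtype.ext ((g.fiberι y).isEmbedding.injective (congrArg Subtype.val hab))
    have hsurj : Function.Surjective h := by
      rintro ⟨x, hx, hxy⟩
      obtain ⟨z, rfl⟩ := hr.ge hxy
      exact ⟨⟨z, hx⟩, rfl⟩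
    exact ((Equiv.ofBijective h ⟨hinj, hsurj⟩).toHomeomorphOfIsInducing hi).isHomeomorph.topologicalKrullDim_eq
  rw [← hdim, le_dim_iff (K := Y.residueField y) (g.fiberToSpecResidueField y) _
    (hZ.preimage' (g.fiberι y).continuous)]
  constructor
  · rintro ⟨z, hz, hn⟩
    exact ⟨g.fiberι y z, hz, hr.le ⟨z, rfl⟩, hdl z ▸ hn⟩
  · rintro ⟨x, hx, hxy, hn⟩
    obtain ⟨z, rfl⟩ := hr.ge hxy
    exact ⟨z, hx, (hdl z).symm ▸ hn⟩

theorem withBot_ext {a b : WithBot ℕ∞} (h : ∀ n : ℕ, (n : WithBot ℕ∞) ≤ a ↔ (n : WithBot ℕ∞) ≤ b) :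
    a = b := by
  have key : ∀ {a b : WithBot ℕ∞}, (∀ n : ℕ, (n : WithBot ℕ∞) ≤ a → (n : WithBot ℕ∞) ≤ b) →
      a ≤ b := by
    intro a b h
    induction a using WithBot.recBotCoe with
    | bot => exact bot_le
    | coe a =>
      induction b using WithBot.recBotCoe with
      | bot =>
        have := h 0 (by exact_mod_cast (zero_le : (0 : ℕ∞) ≤ a))
        simp at this
      | coe b =>
        refine WithBot.coe_le_coe.2 (ENat.forall_natCast_le_iff_le.1 fun n hn => ?_)
        have := h n (by exact_mod_cast hn)
        exact_mod_cast this
  exact le_antisymm (key fun n => (h n).1) (key fun n => (h n).2)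

theorem le_add_iff_sub {a : WithBot ℕ∞} (n d : ℕ) :
    (n : WithBot ℕ∞) ≤ a + d ↔ ((n - d : ℕ) : WithBot ℕ∞) ≤ a := by
  induction a using WithBot.recBotCoe with
  | bot => simp
  | coe a =>
    have h1 : ((a : WithBot ℕ∞) + (d : WithBot ℕ∞)) = ((a + d : ℕ∞) : WithBot ℕ∞) := by push_cast; rfl
    rw [h1]
    change (((n : ℕ∞) : WithBot ℕ∞)) ≤ _ ↔ (((n - d : ℕ) : ℕ∞) : WithBot ℕ∞) ≤ _
    rw [WithBot.coe_le_coe, WithBot.coe_le_coe]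
    induction a using ENat.recTopCoe with
    | top => simp
    | coe a => norm_cast; omega

/-- Let `X`, `Y` be schemes of finite type over a field `k` and `g : X → Y` a morphism over
`k`.  If `X₁ ⊆ X` and `Y₁ ⊆ Y` are constructible subsets with `Y₁` nonempty, `g` maps `X₁`
into `Y₁`, and every fiber `X₁ ∩ g⁻¹(y)` over a point `y ∈ Y₁` has topological Krull
dimension `d`, then `dim X₁ = dim Y₁ + d`. -/
theorem dim_constructible_of_fibers (k : Type*) [Field k]
    (X Y : Scheme) (fX : X ⟶ Spec (CommRingCat.of k)) (fY : Y ⟶ Spec (CommRingCat.of k))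
    [LocallyOfFiniteType fX] [QuasiCompact fX]
    [LocallyOfFiniteType fY] [QuasiCompact fY]
    (g : X ⟶ Y) (hg : g ≫ fY = fX)
    (X₁ : Set X) (Y₁ : Set Y)
    (hX₁ : IsConstructibleSet X₁) (hY₁ : IsConstructibleSet Y₁) (hY₁ne : Y₁.Nonempty)
    (hmaps : Set.MapsTo g.base X₁ Y₁)
    (d : ℕ)
    (hfib : ∀ y ∈ Y₁, topologicalKrullDim ↥(X₁ ∩ g.base ⁻¹' {y}) = (d : WithBot ℕ∞)) :
    topologicalKrullDim ↥X₁ = topologicalKrullDim ↥Y₁ + (d : WithBot ℕ∞) := by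
  subst hg
  have : LocallyOfFiniteType g := locallyOfFiniteType_of_comp g fY
  refine withBot_ext fun n => ?_
  rw [le_add_iff_sub, le_dim_iff (g ≫ fY) X₁ hX₁, le_dim_iff fY Y₁ hY₁]
  constructor
  · rintro ⟨x, hx, hn⟩
    refine ⟨g x, hmaps hx, ?_⟩
    rw [dl_comp] at hn
    have hle : dl g x ≤ d := by
      by_contra hlt
      have h1 : ((d + 1 : ℕ) : ℕ∞) ≤ dl g x := by
        push_cast
        exact Order.add_one_le_of_lt (not_le.1 hlt)
      have h2 := (le_dim_fiber_iff g X₁ hX₁ (g x) (d + 1)).2 ⟨x, hx, rfl, h1⟩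
      rw [hfib (g x) (hmaps hx)] at h2
      have h3 : d + 1 ≤ d := by exact_mod_cast h2
      omega
    have h4 : (n : ℕ∞) ≤ dl fY (g x) + d := hn.trans (by gcongr)
    push_cast
    exact tsub_le_iff_right.2 h4
  · rintro ⟨y, hy, hn⟩
    obtain ⟨x, hx, rfl, hd⟩ := (le_dim_fiber_iff g X₁ hX₁ y d).1 (hfib y hy).ge
    refine ⟨x, hx, ?_⟩
    rw [dl_comp]
    push_cast at hn
    exact (tsub_le_iff_right.1 hn).trans (by gcongr)
end

section
/- Let n ≥ 1 be an integer and let a = (a_1 ≤ ... ≤ a_n) and b = (b_1 ≤ ... ≤ b_n) be weakly increasing sequences of nonnegative integers with a_i ≤ m+1 and b_i ≤ m+1 for all i. Let D_a and D_b be the n × n diagonal matrices over R with diagonal entries x^{a_1}, ..., x^{a_n} and x^{b_1}, ..., x^{b_n} respectively. If there exist invertible n × n matrices P and Q over R such that P · D_a · Q = D_b, then a_i = b_i for all i. (In other words, the partition type of a matrix over R in diagonal form does not depend on the choice of bases.) -/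
set_option synthInstance.maxHeartbeats 400000
set_option maxHeartbeats 800000

open Polynomial

/-- The truncated polynomial ring `R = k[X]/(X^(m+1))`. -/
abbrev TruncR (k : Type*) [Field k] (m : ℕ) : Type _ :=
  Polynomial k ⧸ Ideal.span {(Polynomial.X : Polynomial k) ^ (m + 1)}

/-- The image `x` of `X` in `R = k[X]/(X^(m+1))`. -/
noncomputable def truncX (k : Type*) [Field k] (m : ℕ) : TruncR k m :=
  Ideal.Quotient.mk _ (Polynomial.X : Polynomial k)

/-- Evaluation at `x = 0`. -/
noncomputable def truncRes (k : Type*) [Field k] (m : ℕ) : TruncR k m →+* k :=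
  Ideal.Quotient.lift _ (Polynomial.constantCoeff : Polynomial k →+* k) (by
    intro p hp
    rw [Ideal.mem_span_singleton] at hp
    obtain ⟨q, rfl⟩ := hp
    simp)

theorem truncRes_eq_zero {k : Type*} [Field k] {m a b : ℕ} (hab : a < b) (hb : b ≤ m + 1)
    (y z : TruncR k m) (h : y * truncX k m ^ a = truncX k m ^ b * z) :
    truncRes k m y = 0 := by
  obtain ⟨p, rfl⟩ := Ideal.Quotient.mk_surjective y
  obtain ⟨q, rfl⟩ := Ideal.Quotient.mk_surjective z
  unfold truncX at h
  rw [← map_pow, ← map_pow, ← map_mul, ← map_mul, Ideal.Quotient.eq,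
    Ideal.mem_span_singleton] at h
  have h1 : (X : Polynomial k) ^ (a + 1) ∣ p * X ^ a - X ^ b * q :=
    (pow_dvd_pow _ (by omega)).trans h
  have h2 : (X : Polynomial k) ^ (a + 1) ∣ X ^ b * q :=
    (pow_dvd_pow _ (by omega)).trans (dvd_mul_right _ _)
  have h3 : (X : Polynomial k) ^ (a + 1) ∣ p * X ^ a := (dvd_sub_left h2).1 h1
  rw [pow_succ', mul_dvd_mul_iff_right (pow_ne_zero _ X_ne_zero), X_dvd_iff] at h3
  simpa [truncRes] using h3

theorem diagonal_type_le {k : Type*} [Field k] {m n : ℕ}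
    (a b : Fin n → ℕ) (ha : Monotone a) (hb : Monotone b) (hbm : ∀ i, b i ≤ m + 1)
    (P Q : Matrix (Fin n) (Fin n) (TruncR k m)) (hP : IsUnit P)
    (h : P * Matrix.diagonal (fun i => truncX k m ^ a i) =
      Matrix.diagonal (fun i => truncX k m ^ b i) * Q) (i : Fin n) : b i ≤ a i := by
  by_contra! hi
  have key : ∀ r c, i ≤ r → c ≤ i → truncRes k m (P r c) = 0 := by
    intro r c hr hc
    have h1 := congrFun (congrFun h r) c
    rw [Matrix.mul_diagonal, Matrix.diagonal_mul] at h1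
    exact truncRes_eq_zero (((ha hc).trans_lt hi).trans_le (hb hr)) (hbm r) _ _ h1
  have hdet : truncRes k m P.det = 0 := by
    rw [RingHom.map_det, Matrix.det_apply]
    refine Finset.sum_eq_zero fun σ _ => ?_
    obtain ⟨j, hj, hσ⟩ : ∃ j, j ≤ i ∧ i ≤ σ j := by
      by_contra! hc
      have := Finset.card_le_card_of_injOn (s := Finset.Iic i) (t := Finset.Iio i) σ
        (fun j hj => by simpa using hc j (by simpa using hj)) σ.injective.injOn
      simp at this
    rw [Finset.prod_eq_zero (Finset.mem_univ j), smul_zero]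
    simpa using key _ _ hσ hj
  have hu := ((Matrix.isUnit_iff_isUnit_det P).1 hP).map (truncRes k m)
  rw [hdet] at hu
  exact not_isUnit_zero hu

/-- Over `R = k[X]/(X^{m+1})`, let `a_1 ≤ ... ≤ a_n` and `b_1 ≤ ... ≤ b_n` be weakly
increasing sequences of nonnegative integers, all at most `m+1`, and let `D_a`, `D_b` be the
diagonal matrices with entries `x^{a_i}` resp. `x^{b_i}`.  If `P · D_a · Q = D_b` for some
invertible matrices `P`, `Q` over `R`, then `a = b`: the partition type of a matrix in
diagonal form does not depend on the choice of bases. -/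
theorem diagonal_type_unique (k : Type*) [Field k] (m : ℕ) (n : ℕ) (hn : 1 ≤ n)
    (a b : Fin n → ℕ) (ha : Monotone a) (hb : Monotone b)
    (ham : ∀ i, a i ≤ m + 1) (hbm : ∀ i, b i ≤ m + 1)
    (Da Db : Matrix (Fin n) (Fin n) (TruncR k m))
    (hDa : Da = Matrix.diagonal (fun i => truncX k m ^ a i))
    (hDb : Db = Matrix.diagonal (fun i => truncX k m ^ b i))
    (P Q : Matrix (Fin n) (Fin n) (TruncR k m)) (hP : IsUnit P) (hQ : IsUnit Q)
    (h : P * Da * Q = Db) :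
    ∀ i, a i = b i := by
  subst hDa hDb
  obtain ⟨P, rfl⟩ := hP
  obtain ⟨Q, rfl⟩ := hQ
  intro i
  apply le_antisymm
  · refine diagonal_type_le b a hb ha ham (P⁻¹).val Q.val (P⁻¹).isUnit ?_ i
    rw [← h, mul_assoc, Units.inv_mul_cancel_left]
  · refine diagonal_type_le a b ha hb hbm P.val (Q⁻¹).val P.isUnit ?_ i
    rw [← h, Units.mul_inv_cancel_right]
end
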